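/- arXiv:2409.06826 — 3 statements merged into one kernel-verified Lean document; each statement's English description precedes it below -/
import Mathlib

section
/- Let ℓ, q₁, q₂ be natural numbers with q₁ ≤ ℓ and q₂ ≤ ℓ. Then there exist real coefficients c_p, for q₁ + q₂ ≤ p ≤ 2ℓ, such that the polynomial identity Q_{ℓ,q₁} · Q_{ℓ,q₂} = Σ_{p = q₁+q₂}^{2ℓ} c_p · Q_{p, q₁+q₂} holds in ℝ[X]. (Equivalently, the product of associated Legendre functions P_ℓ^{q₁}(x)·P_ℓ^{q₂}(x) is a linear combination of {P_p^{q₁+q₂}(x)}_{p = q₁+q₂}^{2ℓ}; this is Lemma 2 of the paper.) -/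
open Polynomial

/-- `Q p m` is the real polynomial obtained by differentiating `(X² − 1)^p` exactly
`p + m` times; up to a nonzero normalization and the factor `(1 − x²)^{m/2}`, this is the
associated Legendre function `P_p^m`. -/
noncomputable def assocLegendreQ (p m : ℕ) : Polynomial ℝ :=
  Polynomial.derivative^[p + m] ((X ^ 2 - 1 : Polynomial ℝ) ^ p)

theorem base_monic (p : ℕ) : ((X ^ 2 - 1 : Polynomial ℝ) ^ p).Monic := by
  apply Monic.pow
  have := monic_X_pow_sub_C (R := ℝ) 1 (n := 2) (by norm_num)
  simpa using this

theorem base_natDegree (p : ℕ) : ((X ^ 2 - 1 : Polynomial ℝ) ^ p).natDegree = 2 * p := by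
  have h : (X ^ 2 - 1 : Polynomial ℝ).natDegree = 2 := by
    have := natDegree_X_pow_sub_C (R := ℝ) (n := 2) (r := 1)
    simpa using this
  rw [natDegree_pow, h, mul_comm]

theorem coeff_zero_of_gt (p m j : ℕ) (h : p < j + m) : (assocLegendreQ p m).coeff j = 0 := by
  unfold assocLegendreQ
  rw [coeff_iterate_derivative, coeff_eq_zero_of_natDegree_lt, smul_zero]
  rw [base_natDegree]
  omega

theorem coeff_top (d m : ℕ) : (assocLegendreQ (m + d) m).coeff d ≠ 0 := by
  unfold assocLegendreQ
  rw [coeff_iterate_derivative]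
  have h : d + (m + d + m) = ((X ^ 2 - 1 : Polynomial ℝ) ^ (m + d)).natDegree := by
    rw [base_natDegree]; omega
  have h2 : ((X ^ 2 - 1 : Polynomial ℝ) ^ (m + d)).coeff (d + (m + d + m)) = 1 := by
    rw [h]; exact base_monic _
  rw [h2, nsmul_eq_mul, mul_one, Nat.cast_ne_zero]
  exact (Nat.descFactorial_pos.2 (by omega)).ne'

theorem legendre_expand (m d : ℕ) : ∀ f : Polynomial ℝ, (∀ j, d ≤ j → f.coeff j = 0) →
    ∃ c : ℕ → ℝ, f = ∑ p ∈ Finset.Ico m (m + d), C (c p) * assocLegendreQ p m := by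
  induction d with
  | zero =>
    intro f hf
    refine ⟨0, ?_⟩
    ext j
    simp [hf j]
  | succ d ih =>
    intro f hf
    set a := f.coeff d / (assocLegendreQ (m + d) m).coeff d with ha
    obtain ⟨c, hc⟩ := ih (f - C a * assocLegendreQ (m + d) m) (by
      intro j hj
      rw [coeff_sub, coeff_C_mul]
      rcases hj.eq_or_lt with rfl | hj
      · rw [ha, div_mul_cancel₀ _ (coeff_top d m), sub_self]
      · rw [hf j hj, coeff_zero_of_gt _ _ _ (by omega)]; simp)
    refine ⟨Function.update c (m + d) a, ?_⟩
    rw [← add_assoc, Finset.sum_Ico_succ_top (by omega), Function.update_self]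
    rw [Finset.sum_congr rfl (g := fun p => C (c p) * assocLegendreQ p m), ← hc]
    · ring
    · intro p hp
      rw [Finset.mem_Ico] at hp
      rw [Function.update_of_ne (by omega)]

/-- Lemma 2 of the paper. For `q₁, q₂ ≤ ℓ`, the product
`Q_{ℓ,q₁} · Q_{ℓ,q₂}` is a real linear combination of `{Q_{p,q₁+q₂}}_{p=q₁+q₂}^{2ℓ}`;
equivalently, `P_ℓ^{q₁} P_ℓ^{q₂}` is a linear combination of
`{P_p^{q₁+q₂}}_{p=q₁+q₂}^{2ℓ}`. -/
theorem legendre_product_expansion (ℓ q₁ q₂ : ℕ) (h₁ : q₁ ≤ ℓ) (h₂ : q₂ ≤ ℓ) :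
    ∃ c : ℕ → ℝ, assocLegendreQ ℓ q₁ * assocLegendreQ ℓ q₂ =
      ∑ p ∈ Finset.Icc (q₁ + q₂) (2 * ℓ), Polynomial.C (c p) * assocLegendreQ p (q₁ + q₂) := by
  obtain ⟨c, hc⟩ := legendre_expand (q₁ + q₂) (2 * ℓ + 1 - (q₁ + q₂))
    (assocLegendreQ ℓ q₁ * assocLegendreQ ℓ q₂) (by
      intro j hj
      rw [coeff_mul]
      apply Finset.sum_eq_zero
      rintro ⟨a, b⟩ hab
      rw [Finset.HasAntidiagonal.mem_antidiagonal] at hab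
      simp only at hab ⊢
      by_cases h : ℓ < a + q₁
      · rw [coeff_zero_of_gt _ _ _ h, zero_mul]
      · rw [coeff_zero_of_gt ℓ q₂ b (by omega), mul_zero])
  refine ⟨c, hc.trans (Finset.sum_congr ?_ fun _ _ => rfl)⟩
  ext p
  simp only [Finset.mem_Ico, Finset.mem_Icc]
  omega
end

section
/- Let s ≤ n be natural numbers. Every real polynomial of degree at most n − s is a real linear combination of the polynomials Q_{p,s} with s ≤ p ≤ n; i.e., the family {Q_{p,s}}_{p=s}^{n} spans the space of real polynomials of degree ≤ n − s. -/
open Polynomial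

theorem assocLegendreQ_degree (s i : ℕ) : (assocLegendreQ (s + i) s).degree = i := by
  have hd : (X ^ 2 - 1 : Polynomial ℝ).natDegree = 2 := by
    simpa using natDegree_X_pow_sub_C (n := 2) (r := (1 : ℝ))
  have hm : (X ^ 2 - 1 : Polynomial ℝ).Monic := by
    simpa using monic_X_pow_sub_C (1 : ℝ) (n := 2) (by norm_num)
  have hD : ((X ^ 2 - 1 : Polynomial ℝ) ^ (s + i)).natDegree = i + (s + i + s) := by
    rw [hm.natDegree_pow, hd]; ring
  have hc : ((X ^ 2 - 1 : Polynomial ℝ) ^ (s + i)).coeff (i + (s + i + s)) = 1 := by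
    rw [← hD]; exact (hm.pow _).coeff_natDegree
  apply degree_eq_of_le_of_coeff_ne_zero
  · apply degree_le_of_natDegree_le
    refine (natDegree_iterate_derivative _ _).trans ?_
    rw [hD]; omega
  · unfold assocLegendreQ
    rw [coeff_iterate_derivative, hc]
    simp [Nat.descFactorial_eq_zero_iff_lt]

noncomputable def legendreSeq (s : ℕ) : Polynomial.Sequence ℝ where
  elems' i := assocLegendreQ (s + i) s
  degree_eq' i := assocLegendreQ_degree s i

/-- For `s ≤ n`, every real polynomial of degree at most `n − s` is a
real linear combination of the polynomials `Q_{p,s}` with `s ≤ p ≤ n`. -/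
theorem legendreQ_span (s n : ℕ) (h : s ≤ n) (f : Polynomial ℝ)
    (hf : f.natDegree ≤ n - s) :
    ∃ c : ℕ → ℝ, f = ∑ p ∈ Finset.Icc s n, Polynomial.C (c p) * assocLegendreQ p s := by
  have hspan := (legendreSeq s).span_degreeLE (m := n - s) (fun i _ => by
    rw [isUnit_iff_ne_zero, Ne, leadingCoeff_eq_zero]
    exact (legendreSeq s).ne_zero i)
  have hmem : f ∈ degreeLE ℝ (n - s : ℕ) := mem_degreeLE.mpr (degree_le_of_natDegree_le hf)
  rw [← hspan] at hmem
  have hmem2 : f ∈ Submodule.span ℝ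
      ((fun p => assocLegendreQ p s) '' (Finset.Icc s n : Finset ℕ)) := by
    refine Submodule.span_mono ?_ hmem
    rintro _ ⟨i, hi, rfl⟩
    have hi' : i ≤ n - s := hi
    exact ⟨s + i, by simp only [Finset.coe_Icc, Set.mem_Icc]; omega, rfl⟩
  obtain ⟨c, hc⟩ := (Submodule.mem_span_image_finset_iff_exists_fun' ℝ).mp hmem2
  exact ⟨c, by rw [← hc]; simp only [smul_eq_C_mul]⟩
end

section
/- Let ε > 0 and let z : [0, ∞) → ℝ be differentiable with z′(t) = 2·z(t)·(z(t) − ε) for all t ≥ 0. If z(0) < ε, then z(t) → 0 as t → ∞. (This expresses the stability, for ε > 0, of the family of steady states z = 0 of the truncated ℓ=1 amplitude system, with basin of attraction bounded by z = ε.) -/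
/-- Let `ε > 0` and let `z` be differentiable on `[0, ∞)` with
`z' = 2z(z − ε)` there. If `z(0) < ε`, then `z(t) → 0` as `t → ∞` (stability of the
steady-state family `z = 0` of the truncated `ℓ = 1` amplitude system, with basin of
attraction bounded by `z = ε`). -/
theorem z_ode_tendsto_zero (ε : ℝ) (hε : 0 < ε) (z : ℝ → ℝ)
    (hz : ∀ t ∈ Set.Ici (0 : ℝ),
      HasDerivWithinAt z (2 * z t * (z t - ε)) (Set.Ici (0 : ℝ)) t)
    (h0 : z 0 < ε) :
    Filter.Tendsto z Filter.atTop (nhds 0) := by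
  have hzc : ContinuousOn z (Set.Ici 0) := fun t ht => (hz t ht).continuousWithinAt
  have hc : Continuous (fun t : ℝ => 2 * (z (max t 0) - ε)) := by
    have h1 : Continuous (fun t : ℝ => z (max t 0)) :=
      hzc.comp_continuous (by fun_prop) (fun t => le_max_right t 0)
    exact continuous_const.mul (h1.sub continuous_const)
  obtain ⟨P, hP⟩ : ∃ P : ℝ → ℝ, ∀ t, HasDerivAt P (2 * (z (max t 0) - ε)) t :=
    ⟨fun t => ∫ s in (0 : ℝ)..t, 2 * (z (max s 0) - ε),
      fun t => hc.integral_hasStrictDerivAt 0 t |>.hasDerivAt⟩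
  have hE : ∀ t : ℝ, HasDerivAt (fun t : ℝ => Real.exp (-(2 * ε) * t))
      (Real.exp (-(2 * ε) * t) * (-(2 * ε))) t := by
    intro t
    simpa using ((hasDerivAt_id t).const_mul (-(2 * ε))).exp
  have hW : ∀ t ∈ Set.Ici (0 : ℝ), HasDerivWithinAt
      (fun t => (z t * (1 - z 0 / ε + z 0 / ε * Real.exp (-(2 * ε) * t))
        - z 0 * Real.exp (-(2 * ε) * t)) * Real.exp (-P t)) 0 (Set.Ici 0) t := by
    intro t ht
    have hD := ((hE t).const_mul (z 0 / ε)).const_add (1 - z 0 / ε)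
    have h := (((hz t ht).mul hD.hasDerivWithinAt).sub
      ((hE t).const_mul (z 0)).hasDerivWithinAt).mul (hP t).neg.exp.hasDerivWithinAt
    refine h.congr_deriv ?_
    rw [max_eq_left (Set.mem_Ici.1 ht)]
    simp only [Pi.mul_apply, Pi.sub_apply, Pi.neg_apply]
    field_simp
    ring
  have hw : ∀ t, 0 ≤ t → z t * (1 - z 0 / ε + z 0 / ε * Real.exp (-(2 * ε) * t))
        = z 0 * Real.exp (-(2 * ε) * t) := by
    intro t ht
    have h := constant_of_has_deriv_right_zero (a := 0) (b := t)
      (fun x hx => ((hW x hx.1).continuousWithinAt).mono Set.Icc_subset_Ici_self)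
      (fun x hx => (hW x hx.1).mono (Set.Ici_subset_Ici.2 hx.1)) t ⟨ht, le_rfl⟩
    have h2 : (z t * (1 - z 0 / ε + z 0 / ε * Real.exp (-(2 * ε) * t))
        - z 0 * Real.exp (-(2 * ε) * t)) * Real.exp (-P t) = 0 := by
      simpa using h
    have h3 := (mul_eq_zero.1 h2).resolve_right (Real.exp_ne_zero _)
    linarith
  have he : Filter.Tendsto (fun t : ℝ => Real.exp (-(2 * ε) * t)) Filter.atTop (nhds 0) :=
    Real.tendsto_exp_atBot.comp
      (Filter.tendsto_id.const_mul_atTop_of_neg (by linarith))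
  have hne : 1 - z 0 / ε ≠ 0 := by
    have : z 0 / ε < 1 := (div_lt_one hε).2 h0
    linarith
  have hDl : Filter.Tendsto (fun t : ℝ => 1 - z 0 / ε + z 0 / ε * Real.exp (-(2 * ε) * t))
      Filter.atTop (nhds (1 - z 0 / ε)) := by
    simpa using (he.const_mul (z 0 / ε)).const_add (1 - z 0 / ε)
  have hlim := (he.const_mul (z 0)).div hDl hne
  rw [mul_zero, zero_div] at hlim
  refine hlim.congr' ?_
  filter_upwards [Filter.eventually_ge_atTop 0, hDl.eventually_ne hne] with t ht hd
  simp only [Pi.div_apply]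
  rw [← hw t ht, mul_div_cancel_right₀ _ hd]
end
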